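/- arXiv:2010.09988 — 5 statements merged into one kernel-verified Lean document; each statement's English description precedes it below -/
import Mathlib

section
/- Let ε > 0, let D ⊂ ℝ^d be a nonempty bounded open connected set, and let U be continuously differentiable on an open set containing the closure of D. Suppose the boundary ∂D is the union of two disjoint nonempty closed sets Γ_A and Γ_B. Let q be continuous on the closure of D, twice continuously differentiable on D, and satisfy εΔq(x) − ∇U(x)·∇q(x) = 0 for all x ∈ D, with q = 0 on Γ_A and q = 1 on Γ_B. Then 0 < q(x) < 1 for every x ∈ D. -/
open scoped InnerProductSpace

/-- The Laplacian of `f : ℝ^d → ℝ`, as the sum of second partial derivatives. -/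
noncomputable def lap {d : ℕ} (f : EuclideanSpace ℝ (Fin d) → ℝ)
    (x : EuclideanSpace ℝ (Fin d)) : ℝ :=
  ∑ i : Fin d, fderiv ℝ (fun y => fderiv ℝ f y (EuclideanSpace.single i 1)) x
    (EuclideanSpace.single i 1)

lemma aux_second {φ ψ : ℝ → ℝ} {a : ℝ} (hφ : ∀ᶠ t in nhds 0, HasDerivAt φ (ψ t) t)
    (hψ : HasDerivAt ψ a 0) (hmax : IsLocalMax φ 0) : a ≤ 0 := by
  by_contra! ha
  have e1 : deriv φ =ᶠ[nhds 0] ψ := hφ.mono fun t ht => ht.deriv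
  have e2 : deriv (deriv φ) 0 = a := by rw [e1.deriv_eq]; exact hψ.deriv
  have e3 : deriv φ 0 = 0 := hmax.deriv_eq_zero
  have hmin : IsLocalMin φ 0 := isLocalMin_of_deriv_deriv_pos (by rw [e2]; exact ha) e3
    hφ.self_of_nhds.continuousAt
  have hc : φ =ᶠ[nhds 0] fun _ => φ 0 := by
    filter_upwards [hmin, hmax] with t h1 h2
    exact le_antisymm h2 h1
  have e4 : deriv φ =ᶠ[nhds 0] fun _ => 0 := by
    filter_upwards [hc.eventually_nhds] with t ht
    have : φ =ᶠ[nhds t] fun _ => φ 0 := ht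
    rw [this.deriv_eq]; simp
  have : deriv (deriv φ) 0 = 0 := by rw [e4.deriv_eq]; simp
  linarith

/-- the barrier -/
noncomputable def bar {d : ℕ} (α : ℝ) (c x : EuclideanSpace ℝ (Fin d)) : ℝ :=
  Real.exp (-α * ‖x - c‖ ^ 2)

lemma bar_deriv {d : ℕ} (α : ℝ) (c x : EuclideanSpace ℝ (Fin d)) :
    HasFDerivAt (bar α c) ((-2 * α * bar α c x) • innerSL ℝ (x - c)) x := by
  have h1 : HasFDerivAt (fun y : EuclideanSpace ℝ (Fin d) => ‖y - c‖ ^ 2)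
      (2 • innerSL ℝ (x - c)) x := by
    have := ((hasFDerivAt_id (𝕜 := ℝ) x).sub_const c).norm_sq
    simpa using this
  have h2 := (h1.const_mul (-α)).exp
  refine h2.congr_fderiv ?_
  ext v
  simp [bar]
  ring

lemma aux_point {d : ℕ} (D : Set (EuclideanSpace ℝ (Fin d))) (hD : IsOpen D)
    (u : EuclideanSpace ℝ (Fin d) → ℝ) (hu : ContDiffOn ℝ 2 u D)
    (z c : EuclideanSpace ℝ (Fin d)) (hz : z ∈ D) (α δ : ℝ)
    (hmax : IsLocalMax (fun x => u x + δ * bar α c x) z) :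
    fderiv ℝ u z = (δ * (2 * α * bar α c z)) • innerSL ℝ (z - c) ∧
    lap u z + δ * (bar α c z * (4 * α ^ 2 * ‖z - c‖ ^ 2 - 2 * α * d)) ≤ 0 := by
  have hdiff : ∀ x ∈ D, HasFDerivAt u (fderiv ℝ u x) x := fun x hx =>
    (((hu.differentiableOn (by norm_num)) x hx).differentiableAt (hD.mem_nhds hx)).hasFDerivAt
  constructor
  · have h := (hdiff z hz).add ((bar_deriv α c z).const_mul δ)
    have h0 := hmax.hasFDerivAt_eq_zero h
    have := eq_neg_of_add_eq_zero_left h0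
    rw [this]
    ext v
    simp
    ring
  · have key : ∀ i : Fin d, fderiv ℝ (fun y => fderiv ℝ u y (EuclideanSpace.single i 1)) z
        (EuclideanSpace.single i 1) +
        δ * (bar α c z * (4 * α ^ 2 * (z i - c i) ^ 2 - 2 * α)) ≤ 0 := by
      intro i
      set e : EuclideanSpace ℝ (Fin d) := EuclideanSpace.single i 1 with he
      have hie : ∀ v : EuclideanSpace ℝ (Fin d), inner ℝ v e = v i := by
        intro v; rw [he, EuclideanSpace.inner_single_right]; simp
      have hl : ∀ t : ℝ, HasDerivAt (fun t : ℝ => z + t • e) e t := by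
        intro t
        simpa using ((hasDerivAt_id t).smul_const e).const_add z
      have hl0 : z + (0:ℝ) • e = z := by simp
      have hcont : Filter.Tendsto (fun t : ℝ => z + t • e) (nhds 0) (nhds z) := by
        have := (hl 0).continuousAt.tendsto
        rwa [hl0] at this
      have hb : ∀ t : ℝ, HasDerivAt (fun t : ℝ => bar α c (z + t • e))
          (-2 * α * bar α c (z + t • e) * (z i - c i + t)) t := by
        intro t
        have := (bar_deriv α c (z + t • e)).comp_hasDerivAt t (hl t)
        refine this.congr_deriv ?_
        simp only [FunLike.coe_smul, Pi.smul_apply, innerSL_apply_apply, hie, smul_eq_mul]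
        simp [he]
        left; ring
      refine aux_second (φ := fun t => u (z + t • e) + δ * bar α c (z + t • e))
        (ψ := fun t => fderiv ℝ u (z + t • e) e +
          δ * (-2 * α * bar α c (z + t • e) * (z i - c i + t))) ?_ ?_ ?_
      · filter_upwards [hcont (hD.mem_nhds hz)] with t ht
        exact ((hdiff _ ht).comp_hasDerivAt t (hl t)).add ((hb t).const_mul δ)
      · have hd2 : DifferentiableAt ℝ (fun y => fderiv ℝ u y e) z := by
          have h1 : ContDiffAt ℝ 1 (fderiv ℝ u) z :=
            (hu.contDiffAt (hD.mem_nhds hz)).fderiv_right (by norm_num)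
          exact (h1.differentiableAt (by norm_num)).clm_apply (differentiableAt_const e)
        have h2 := hd2.hasFDerivAt
        rw [← hl0] at h2
        have h3 := h2.comp_hasDerivAt (0:ℝ) (hl 0)
        rw [hl0] at h3
        have h4 := (((hb 0).const_mul (-2 * α)).mul
          ((hasDerivAt_id (0:ℝ)).const_add (z i - c i))).const_mul δ
        have h5 := h3.add h4
        rw [hl0] at h5
        refine (h5.congr_deriv ?_).congr_of_eventuallyEq (Filter.Eventually.of_forall fun t => ?_)
        · simp only [id]; ring
        · simp
      · have := hcont.eventually hmax
        simpa [IsLocalMax, IsMaxFilter] using this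
    have hs := Finset.sum_nonpos (s := Finset.univ) fun i _ => key i
    rw [Finset.sum_add_distrib] at hs
    have hn : ‖z - c‖ ^ 2 = ∑ i, (z i - c i) ^ 2 := by
      rw [EuclideanSpace.norm_sq_eq]; simp
    have : ∑ i : Fin d, δ * (bar α c z * (4 * α ^ 2 * (z i - c i) ^ 2 - 2 * α)) =
        δ * (bar α c z * (4 * α ^ 2 * ‖z - c‖ ^ 2 - 2 * α * d)) := by
      rw [← Finset.mul_sum, ← Finset.mul_sum, Finset.sum_sub_distrib, ← Finset.mul_sum, hn]
      simp; left; left; ring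
    rw [this] at hs
    exact hs

lemma aux_hopf {d : ℕ} (ε : ℝ) (hε : 0 < ε) (D : Set (EuclideanSpace ℝ (Fin d))) (hD : IsOpen D)
    (b : EuclideanSpace ℝ (Fin d) → EuclideanSpace ℝ (Fin d)) (hb : ContinuousOn b D)
    (u : EuclideanSpace ℝ (Fin d) → ℝ) (hu : ContDiffOn ℝ 2 u D)
    (hpde : ∀ x ∈ D, ε * lap u x - fderiv ℝ u x (b x) = 0)
    (M : ℝ) (hM : ∀ x ∈ D, u x ≤ M) (y c : EuclideanSpace ℝ (Fin d)) (hy : y ∈ D)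
    (huy : u y = M) (R : ℝ) (hR : 0 < R) (hyc : ‖y - c‖ = R)
    (hlt : ∀ x ∈ D, ‖x - c‖ ≤ R → x ≠ y → u x < M) : False := by
  obtain ⟨r0, hr0, hball⟩ := Metric.nhds_basis_closedBall.mem_iff.1 (hD.mem_nhds hy)
  set r := min r0 (R / 2) with hr
  have hrpos : 0 < r := by positivity
  have hrR : r ≤ R / 2 := min_le_right _ _
  have hBD : Metric.closedBall y r ⊆ D :=
    (Metric.closedBall_subset_closedBall (min_le_left _ _)).trans hball
  have hcomp : IsCompact (Metric.closedBall y r) := isCompact_closedBall _ _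
  obtain ⟨B, hB⟩ := hcomp.exists_bound_of_continuousOn (hb.mono hBD)
  have hB0 : 0 ≤ B := (norm_nonneg _).trans (hB y (Metric.mem_closedBall_self hrpos.le))
  obtain ⟨α, hα, hα0⟩ : ∃ α : ℝ, 2 * ε * d + 3 * B * R < α * (ε * R ^ 2) ∧ 0 < α := by
    have hp : 0 < ε * R ^ 2 := by positivity
    refine ⟨(2 * ε * d + 3 * B * R + 1) / (ε * R ^ 2), ?_, by positivity⟩
    rw [div_mul_cancel₀ _ hp.ne']; linarith
  have hbc : Continuous (bar α c) := by unfold bar; fun_prop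
  have hbpos : ∀ x, 0 < bar α c x := fun x => Real.exp_pos _
  have hb1 : ∀ x, bar α c x ≤ 1 := fun x => by
    unfold bar; rw [Real.exp_le_one_iff]; nlinarith [sq_nonneg ‖x - c‖]
  have huc : ContinuousOn u (Metric.closedBall y r) := hu.continuousOn.mono hBD
  -- compact piece of the sphere
  obtain ⟨η, hη, hηu⟩ : ∃ η > 0, ∀ x ∈ Metric.sphere y r ∩ Metric.closedBall c R,
      u x ≤ M - η := by
    have hK : IsCompact (Metric.sphere y r ∩ Metric.closedBall c R) :=
      (isCompact_sphere _ _).inter_right Metric.isClosed_closedBall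
    rcases (Metric.sphere y r ∩ Metric.closedBall c R).eq_empty_or_nonempty with he | hne
    · exact ⟨1, one_pos, by rw [he]; simp⟩
    · obtain ⟨p, hp, hpm⟩ := hK.exists_isMaxOn hne
        (huc.mono (Set.inter_subset_left.trans Metric.sphere_subset_closedBall))
      have hpl : u p < M := by
        refine hlt p (hBD (Metric.sphere_subset_closedBall hp.1)) ?_ ?_
        · rw [← dist_eq_norm]; exact hp.2
        · rintro rfl
          have := hp.1
          simp at this
          linarith
      refine ⟨M - u p, by linarith, fun x hx => ?_⟩
      have : u x ≤ u p := hpm hx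
      linarith
  set δ := η / 2 with hδ
  have hδ0 : 0 < δ := by positivity
  obtain ⟨z, hz, hzm⟩ := hcomp.exists_isMaxOn ⟨y, Metric.mem_closedBall_self hrpos.le⟩
    (huc.add (continuousOn_const.mul hbc.continuousOn) :
      ContinuousOn (fun x => u x + δ * bar α c x) (Metric.closedBall y r))
  have hzy : u y + δ * bar α c y ≤ u z + δ * bar α c z :=
    hzm (Metric.mem_closedBall_self hrpos.le)
  have hzin : z ∈ Metric.ball y r := by
    by_contra hns
    have hzs : z ∈ Metric.sphere y r := by
      simp only [Metric.mem_ball, Metric.mem_closedBall, Metric.mem_sphere, not_lt] at *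
      exact le_antisymm hz hns
    by_cases hzc : z ∈ Metric.closedBall c R
    · have := hηu z ⟨hzs, hzc⟩
      nlinarith [hb1 z, hbpos y]
    · have h1 : R < ‖z - c‖ := by
        rw [← dist_eq_norm]; simpa using hzc
      have h2 : bar α c z < bar α c y := by
        unfold bar
        rw [Real.exp_lt_exp, hyc]
        have : R ^ 2 < ‖z - c‖ ^ 2 := by gcongr
        nlinarith
      have := hM z (hBD hz)
      nlinarith
  have hloc : IsLocalMax (fun x => u x + δ * bar α c x) z :=
    hzm.isLocalMax (Filter.mem_of_superset (Metric.isOpen_ball.mem_nhds hzin)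
      Metric.ball_subset_closedBall)
  obtain ⟨h1, h2⟩ := aux_point D hD u hu z c (hBD hz) α δ hloc
  have h3 := hpde z (hBD hz)
  rw [h1] at h3
  simp only [FunLike.coe_smul, Pi.smul_apply, innerSL_apply_apply, smul_eq_mul] at h3
  have hzyr : ‖z - y‖ ≤ r := by rw [← dist_eq_norm]; exact hz
  have hlow : R / 2 ≤ ‖z - c‖ := by
    have := norm_sub_le_norm_sub_add_norm_sub y z c
    rw [norm_sub_rev y z] at this
    linarith
  have hup : ‖z - c‖ ≤ 3 * R / 2 := by
    have := norm_sub_le_norm_sub_add_norm_sub z y c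
    linarith
  have hin : -(3 * R / 2 * B) ≤ inner ℝ (z - c) (b z) := by
    have ha := abs_real_inner_le_norm (z - c) (b z)
    have hb' : ‖z - c‖ * ‖b z‖ ≤ 3 * R / 2 * B := by
      gcongr; exact hB z hz
    linarith [neg_abs_le (inner ℝ (z - c) (b z))]
  set I : ℝ := inner ℝ (z - c) (b z)
  set g := bar α c z
  have hg : 0 < g := hbpos z
  have h4 : (δ * g * α) * (2 * I + ε * (4 * α * ‖z - c‖ ^ 2 - 2 * d)) ≤ 0 := by
    nlinarith [mul_nonpos_of_nonneg_of_nonpos hε.le h2]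
  have h5 : 0 < 2 * I + ε * (4 * α * ‖z - c‖ ^ 2 - 2 * d) := by
    have h6 : (R / 2) ^ 2 ≤ ‖z - c‖ ^ 2 := by gcongr
    have h7 := mul_le_mul_of_nonneg_left h6 (mul_pos hε hα0).le
    nlinarith
  have : 0 < (δ * g * α) * (2 * I + ε * (4 * α * ‖z - c‖ ^ 2 - 2 * d)) := by positivity
  linarith

lemma aux_strong {d : ℕ} (ε : ℝ) (hε : 0 < ε) (D : Set (EuclideanSpace ℝ (Fin d)))
    (hD : IsOpen D) (hDc : IsPreconnected D)
    (b : EuclideanSpace ℝ (Fin d) → EuclideanSpace ℝ (Fin d)) (hb : ContinuousOn b D)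
    (u : EuclideanSpace ℝ (Fin d) → ℝ) (hu : ContDiffOn ℝ 2 u D)
    (hpde : ∀ x ∈ D, ε * lap u x - fderiv ℝ u x (b x) = 0)
    (M : ℝ) (hM : ∀ x ∈ D, u x ≤ M) (p : EuclideanSpace ℝ (Fin d)) (hp : p ∈ D)
    (hup : u p = M) : ∀ x ∈ D, u x = M := by
  have huc := hu.continuousOn
  have hopenN : IsOpen (D ∩ u ⁻¹' Set.Iio M) := huc.isOpen_inter_preimage hD isOpen_Iio
  have hopenS : IsOpen (D ∩ u ⁻¹' {M}) := by
    rw [isOpen_iff_mem_nhds]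
    rintro x0 ⟨hx0, hx0M⟩
    by_contra hnot
    obtain ⟨ρ, hρ, hball⟩ := Metric.nhds_basis_closedBall.mem_iff.1 (hD.mem_nhds hx0)
    have : ¬ Metric.ball x0 (ρ / 2) ⊆ D ∩ u ⁻¹' {M} := fun h =>
      hnot (Filter.mem_of_superset (Metric.ball_mem_nhds _ (by positivity)) h)
    obtain ⟨x1, hx1, hx1n⟩ := Set.not_subset.1 this
    have hK : IsCompact (Metric.closedBall x0 ρ ∩ u ⁻¹' {M}) :=
      (isCompact_closedBall x0 ρ).of_isClosed_subset
        ((huc.mono hball).preimage_isClosed_of_isClosed Metric.isClosed_closedBall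
          isClosed_singleton) Set.inter_subset_left
    obtain ⟨y, hy, hym⟩ := hK.exists_isMinOn ⟨x0, Metric.mem_closedBall_self hρ.le, hx0M⟩
      (f := fun y => dist y x1) (by fun_prop)
    have hyD : y ∈ D := hball hy.1
    have huy : u y = M := hy.2
    have hR0 : dist y x1 ≤ dist x0 x1 := hym ⟨Metric.mem_closedBall_self hρ.le, hx0M⟩
    rw [Metric.mem_ball, dist_comm] at hx1
    have hyx : 0 < dist y x1 := by
      rw [dist_pos]; rintro rfl; exact hx1n ⟨hyD, huy⟩
    set R := dist y x1 with hR
    have hv : ‖y - x1‖ = R := (dist_eq_norm _ _).symm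
    refine aux_hopf ε hε D hD b hb u hu hpde M hM y (x1 + (1/2:ℝ) • (y - x1)) hyD huy (R / 2)
      (by positivity) ?_ ?_
    · have : y - (x1 + (1/2:ℝ) • (y - x1)) = (1/2:ℝ) • (y - x1) := by module
      rw [this, norm_smul, hv]; norm_num; ring
    · intro x hx hxc hxy
      refine lt_of_le_of_ne (hM x hx) fun hxM => ?_
      have hpar := parallelogram_law_with_norm ℝ (x - (x1 + (1/2:ℝ) • (y - x1)))
        ((1/2:ℝ) • (y - x1))
      have e1 : x - (x1 + (1/2:ℝ) • (y - x1)) + (1/2:ℝ) • (y - x1) = x - x1 := by module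
      have e2 : x - (x1 + (1/2:ℝ) • (y - x1)) - (1/2:ℝ) • (y - x1) = x - y := by module
      have e3 : ‖(1/2:ℝ) • (y - x1)‖ = R / 2 := by rw [norm_smul, hv]; norm_num; ring
      rw [e1, e2, e3] at hpar
      have hpos : 0 < ‖x - y‖ := norm_pos_iff.2 (sub_ne_zero.2 hxy)
      have hlt : ‖x - x1‖ < R := by
        by_contra! hge
        nlinarith [norm_nonneg (x - (x1 + (1/2:ℝ) • (y - x1)))]
      rw [← dist_eq_norm] at hlt
      have hxb : x ∈ Metric.closedBall x0 ρ := by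
        rw [Metric.mem_closedBall]
        have := dist_triangle x x1 x0
        rw [dist_comm x1 x0] at this
        linarith
      have : R ≤ dist x x1 := hym ⟨hxb, hxM⟩
      linarith
  intro x hx
  by_contra hne
  have hlt : u x < M := lt_of_le_of_ne (hM x hx) hne
  obtain ⟨w, hw, h1, h2⟩ := hDc _ _ hopenS hopenN (fun w hw => by
    rcases (hM w hw).lt_or_eq with h | h
    · exact Or.inr ⟨hw, h⟩
    · exact Or.inl ⟨hw, h⟩) ⟨p, hp, hp, hup⟩ ⟨x, hx, hx, hlt⟩
  have ha : u w = M := h1.2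
  have hb' : u w < M := h2.2
  linarith

lemma aux_main {d : ℕ} (ε : ℝ) (hε : 0 < ε) (D : Set (EuclideanSpace ℝ (Fin d)))
    (hD : IsOpen D) (hDb : Bornology.IsBounded D) (hDc : IsPreconnected D)
    (b : EuclideanSpace ℝ (Fin d) → EuclideanSpace ℝ (Fin d)) (hb : ContinuousOn b D)
    (u : EuclideanSpace ℝ (Fin d) → ℝ) (hu : ContDiffOn ℝ 2 u D)
    (huc : ContinuousOn u (closure D))
    (hpde : ∀ x ∈ D, ε * lap u x - fderiv ℝ u x (b x) = 0)
    (K : ℝ) (hK : ∀ x ∈ frontier D, u x ≤ K) (p₁ p₂ : EuclideanSpace ℝ (Fin d))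
    (h₁ : p₁ ∈ frontier D) (h₂ : p₂ ∈ frontier D) (hne : u p₁ ≠ u p₂) :
    ∀ x ∈ D, u x < K := by
  intro x hx
  by_contra! hge
  obtain ⟨p, hp, hpm⟩ := hDb.isCompact_closure.exists_isMaxOn ⟨x, subset_closure hx⟩ huc
  have hle : ∀ w ∈ D, u w ≤ u p := fun w hw => hpm (subset_closure hw)
  obtain ⟨p', hp', hpp⟩ : ∃ p' ∈ D, u p' = u p := by
    by_cases hpD : p ∈ D
    · exact ⟨p, hpD, rfl⟩
    · have : u p ≤ K := hK p (by rw [hD.frontier_eq]; exact ⟨hp, hpD⟩)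
      exact ⟨x, hx, le_antisymm (hle x hx) (by linarith)⟩
  have hconst := aux_strong ε hε D hD hDc b hb u hu hpde (u p) hle p' hp' hpp
  have hcl : Set.EqOn u (fun _ => u p) (closure D) :=
    Set.EqOn.of_subset_closure (s := D) hconst huc continuousOn_const subset_closure subset_rfl
  exact hne ((hcl (frontier_subset_closure h₁)).trans (hcl (frontier_subset_closure h₂)).symm)

/-- The committor function `q` for the generator `Q f = ε Δ f − ∇U·∇f` on a bounded open
connected set `D`, with `q = 0` on `Γ_A` and `q = 1` on `Γ_B`, satisfies `0 < q < 1` in `D`. -/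
theorem stmt_0 {d : ℕ} (ε : ℝ) (hε : 0 < ε)
    (D V ΓA ΓB : Set (EuclideanSpace ℝ (Fin d)))
    (hDopen : IsOpen D) (hDne : D.Nonempty) (hDbdd : Bornology.IsBounded D)
    (hDconn : IsConnected D)
    (hVopen : IsOpen V) (hDV : closure D ⊆ V)
    (U q : EuclideanSpace ℝ (Fin d) → ℝ)
    (hU : ContDiffOn ℝ 1 U V)
    (hΓA : IsClosed ΓA) (hΓB : IsClosed ΓB)
    (hΓAne : ΓA.Nonempty) (hΓBne : ΓB.Nonempty)
    (hdisj : Disjoint ΓA ΓB) (hfront : frontier D = ΓA ∪ ΓB)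
    (hqcont : ContinuousOn q (closure D)) (hq2 : ContDiffOn ℝ 2 q D)
    (hpde : ∀ x ∈ D, ε * lap q x - ⟪gradient U x, gradient q x⟫_ℝ = 0)
    (hqA : ∀ x ∈ ΓA, q x = 0) (hqB : ∀ x ∈ ΓB, q x = 1) :
    ∀ x ∈ D, 0 < q x ∧ q x < 1 := by
  have hb : ContinuousOn (gradient U) D := by
    have h1 : ContinuousOn (fderiv ℝ U) V := hU.continuousOn_fderiv_of_isOpen hVopen le_rfl
    exact ((InnerProductSpace.toDual ℝ (EuclideanSpace ℝ (Fin d))).symm.continuous.comp_continuousOn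
      h1).mono (subset_closure.trans hDV)
  have hpde' : ∀ x ∈ D, ε * lap q x - fderiv ℝ q x (gradient U x) = 0 := by
    intro x hx
    have := hpde x hx
    rw [real_inner_comm] at this
    simpa [gradient] using this
  obtain ⟨pa, hpa⟩ := hΓAne
  obtain ⟨pb, hpb⟩ := hΓBne
  have hfa : pa ∈ frontier D := by rw [hfront]; exact Or.inl hpa
  have hfb : pb ∈ frontier D := by rw [hfront]; exact Or.inr hpb
  have hup := aux_main ε hε D hDopen hDbdd hDconn.isPreconnected (gradient U) hb q hq2 hqcont hpde'
    1 (fun x hx => by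
      rw [hfront] at hx
      rcases hx with h | h
      · rw [hqA x h]; norm_num
      · rw [hqB x h]) pa pb hfa hfb (by rw [hqA _ hpa, hqB _ hpb]; norm_num)
  have hlo := aux_main ε hε D hDopen hDbdd hDconn.isPreconnected (gradient U) hb (fun x => - q x)
    hq2.neg hqcont.neg (fun x hx => by
      have h := hpde' x hx
      have e1 : fderiv ℝ (fun x => - q x) = fun x => - fderiv ℝ q x := by
        funext y; exact fderiv_fun_neg
      have e2 : lap (fun x => - q x) x = - lap q x := by
        simp only [lap, e1, neg_apply, fderiv_fun_neg, Finset.sum_neg_distrib]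
      rw [e2, e1]
      simp only [neg_apply]
      linarith)
    0 (fun x hx => by
      rw [hfront] at hx
      rcases hx with h | h
      · simp [hqA x h]
      · simp [hqB x h]) pa pb hfa hfb (by rw [hqA _ hpa, hqB _ hpb]; norm_num)
  intro x hx
  have := hlo x hx
  exact ⟨by linarith, hup x hx⟩
end

section
/- Let U : ℝ^d → ℝ be continuously differentiable, let T > 0, and let y : [0,T] → ℝ^d be continuously differentiable. Then ∫₀ᵀ ½ |y'(t) + ∇U(y(t))|² dt ≥ 2 (U(y(T)) − U(y(0))). -/
/-- For any continuously differentiable path `y : [0,T] → ℝ^d`, the Freidlin–Wentzell action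
`∫₀ᵀ ½‖y' + ∇U(y)‖² dt` dominates twice the energy gain `2(U(y(T)) − U(y(0)))`. -/
theorem stmt_1 {d : ℕ} (U : EuclideanSpace ℝ (Fin d) → ℝ) (hU : ContDiff ℝ 1 U)
    (T : ℝ) (hT : 0 < T)
    (y y' : ℝ → EuclideanSpace ℝ (Fin d))
    (hy : ∀ t ∈ Set.Icc (0 : ℝ) T, HasDerivWithinAt y (y' t) (Set.Icc (0 : ℝ) T) t)
    (hy' : ContinuousOn y' (Set.Icc (0 : ℝ) T)) :
    2 * (U (y T) - U (y 0)) ≤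
      ∫ t in (0 : ℝ)..T, (1 / 2) * ‖y' t + gradient U (y t)‖ ^ 2 := by
  have hyc : ContinuousOn y (Set.Icc (0 : ℝ) T) := fun t ht => (hy t ht).continuousWithinAt
  have hg : Continuous (gradient U) := by
    unfold gradient
    exact (LinearIsometryEquiv.continuous _).comp (hU.continuous_fderiv one_ne_zero)
  have key := intervalIntegral.sub_le_integral_of_hasDeriv_right_of_le
    (g := fun t => 2 * U (y t)) (g' := fun t => 2 * inner ℝ (gradient U (y t)) (y' t))
    (φ := fun t => (1 / 2) * ‖y' t + gradient U (y t)‖ ^ 2) hT.le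
    (continuousOn_const.mul (hU.continuous.comp_continuousOn hyc)) ?_ ?_ ?_
  · skip
    linarith
  · intro t ht
    have h1 : HasDerivAt y (y' t) t :=
      (hy t (Set.Ioo_subset_Icc_self ht)).hasDerivAt (Icc_mem_nhds ht.1 ht.2)
    have h2 := ((hU.differentiable one_ne_zero) (y t)).hasGradientAt.hasFDerivAt
    have h3 := (h2.comp_hasDerivAt t h1).const_mul 2
    exact h3.hasDerivWithinAt
  · apply ContinuousOn.integrableOn_Icc
    exact continuousOn_const.mul ((hy'.add (hg.comp_continuousOn hyc)).norm.pow 2)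
  · intro t _
    have h1 := norm_add_sq_real (y' t) (gradient U (y t))
    have h2 := norm_sub_sq_real (y' t) (gradient U (y t))
    have h3 := sq_nonneg ‖y' t - gradient U (y t)‖
    have h4 := real_inner_comm (y' t) (gradient U (y t))
    linarith
end

section
/- Let U : ℝ^d → ℝ be continuously differentiable, let a ∈ ℝ^d and E ∈ ℝ. For any T > 0 and any continuously differentiable path y : [0,T] → ℝ^d with y(0) = a, if there exists t_s ∈ [0,T] with U(y(t_s)) ≥ E, then ∫₀ᵀ ½ |y'(t) + ∇U(y(t))|² dt ≥ 2 (E − U(a)). -/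
/-- Any continuously differentiable path starting at `a` that reaches the energy level `E`
has Freidlin–Wentzell action at least `2(E − U(a))`. -/
theorem stmt_2 {d : ℕ} (U : EuclideanSpace ℝ (Fin d) → ℝ) (hU : ContDiff ℝ 1 U)
    (a : EuclideanSpace ℝ (Fin d)) (E : ℝ)
    (T : ℝ) (hT : 0 < T)
    (y y' : ℝ → EuclideanSpace ℝ (Fin d))
    (hy : ∀ t ∈ Set.Icc (0 : ℝ) T, HasDerivWithinAt y (y' t) (Set.Icc (0 : ℝ) T) t)
    (hy' : ContinuousOn y' (Set.Icc (0 : ℝ) T))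
    (hy0 : y 0 = a)
    (hcross : ∃ ts ∈ Set.Icc (0 : ℝ) T, E ≤ U (y ts)) :
    2 * (E - U a) ≤
      ∫ t in (0 : ℝ)..T, (1 / 2) * ‖y' t + gradient U (y t)‖ ^ 2 := by
  obtain ⟨ts, hts, hE⟩ := hcross
  have hyc : ContinuousOn y (Set.Icc 0 T) := fun t ht => (hy t ht).continuousWithinAt
  have hg : Continuous (gradient U) := by
    have h1 : Continuous (fderiv ℝ U) := hU.continuous_fderiv (by norm_num)
    exact (InnerProductSpace.toDual ℝ (EuclideanSpace ℝ (Fin d))).symm.continuous.comp h1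
  have hgc : ContinuousOn (fun t => gradient U (y t)) (Set.Icc 0 T) :=
    hg.comp_continuousOn hyc
  have hF : ContinuousOn (fun t => (1 / 2) * ‖y' t + gradient U (y t)‖ ^ 2) (Set.Icc 0 T) :=
    continuousOn_const.mul ((hy'.add hgc).norm.pow 2)
  have hG : ContinuousOn (fun t => inner ℝ (gradient U (y t)) (y' t)) (Set.Icc 0 T) :=
    hgc.inner hy'
  have hsub : Set.Icc 0 ts ⊆ Set.Icc 0 T := Set.Icc_subset_Icc_right hts.2
  have hsub2 : Set.Icc ts T ⊆ Set.Icc 0 T := Set.Icc_subset_Icc_left hts.1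
  have iF1 := (hF.mono hsub).intervalIntegrable_of_Icc (μ := MeasureTheory.volume) hts.1
  have iF2 := (hF.mono hsub2).intervalIntegrable_of_Icc (μ := MeasureTheory.volume) hts.2
  have iG := (hG.mono hsub).intervalIntegrable_of_Icc (μ := MeasureTheory.volume) hts.1
  have hftc : ∫ t in (0 : ℝ)..ts, inner ℝ (gradient U (y t)) (y' t) = U (y ts) - U (y 0) := by
    refine intervalIntegral.integral_eq_sub_of_hasDerivAt_of_le (f := fun t => U (y t)) hts.1
      (hU.continuous.comp_continuousOn (hyc.mono hsub)) (fun t ht => ?_) iG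
    have h0 : HasDerivAt y (y' t) t :=
      (hy t ⟨ht.1.le, ht.2.le.trans hts.2⟩).hasDerivAt
        (Icc_mem_nhds ht.1 (ht.2.trans_le hts.2))
    have h1 := ((hU.differentiable (by norm_num)) (y t)).hasGradientAt.hasFDerivAt
    have h2 := h1.comp_hasDerivAt t h0
    simpa [Function.comp_def] using h2
  have h1 : ∫ t in (0 : ℝ)..ts, 2 * inner ℝ (gradient U (y t)) (y' t) ≤
      ∫ t in (0 : ℝ)..ts, (1 / 2) * ‖y' t + gradient U (y t)‖ ^ 2 := by
    refine intervalIntegral.integral_mono_on hts.1 (iG.const_mul 2) iF1 (fun t _ => ?_)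
    have e1 := norm_add_sq_real (y' t) (gradient U (y t))
    have e2 := norm_sub_sq_real (y' t) (gradient U (y t))
    have e3 := sq_nonneg ‖y' t - gradient U (y t)‖
    rw [real_inner_comm]
    linarith
  have h2 : 0 ≤ ∫ t in ts..T, (1 / 2) * ‖y' t + gradient U (y t)‖ ^ 2 :=
    intervalIntegral.integral_nonneg hts.2 (fun t _ => by positivity)
  rw [intervalIntegral.integral_const_mul, hftc, hy0] at h1
  rw [← intervalIntegral.integral_add_adjacent_intervals iF1 iF2]
  linarith
end

section
/- Let ε > 0, let Ω ⊆ ℝ^d be open, and let U, q : Ω → ℝ be twice continuously differentiable with q(x) > 0 on Ω and εΔq − ∇U·∇q = 0 on Ω. Set π := e^{−U/ε} and ρ^R := π q (1 − q). Then pointwise on Ω: ε · div( π ∇(ρ^R/π) − ρ^R · (2∇q)/q ) = 0; that is, the density of transition paths ρ^R is annihilated by the adjoint of the controlled generator Q^q f = Qf + (2ε∇q/q)·∇f. -/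
open scoped InnerProductSpace

/-- The divergence of a vector field `F : ℝ^d → ℝ^d`. -/
noncomputable def dvg {d : ℕ} (F : EuclideanSpace ℝ (Fin d) → EuclideanSpace ℝ (Fin d))
    (x : EuclideanSpace ℝ (Fin d)) : ℝ :=
  ∑ i : Fin d, fderiv ℝ F x (EuclideanSpace.single i 1) i

theorem grad_coord {d : ℕ} (f : EuclideanSpace ℝ (Fin d) → ℝ)
    (y : EuclideanSpace ℝ (Fin d)) (i : Fin d) :
    gradient f y i = fderiv ℝ f y (EuclideanSpace.single i 1) := by
  have h : ⟪gradient f y, EuclideanSpace.single i (1:ℝ)⟫_ℝ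
      = fderiv ℝ f y (EuclideanSpace.single i 1) := by
    simp only [gradient, InnerProductSpace.toDual_symm_apply]
  rw [← h, EuclideanSpace.inner_single_right]
  simp

/-- With `π = e^{−U/ε}` and `ρ^R = π q(1−q)`, if `q > 0` is a committor
(`εΔq − ∇U·∇q = 0`) then `ε div(π ∇(ρ^R/π) − ρ^R·(2∇q)/q) = 0`:
the transition-path density is annihilated by the adjoint of the controlled generator. -/
theorem stmt_7 {d : ℕ} (ε : ℝ) (hε : 0 < ε)
    (Ω : Set (EuclideanSpace ℝ (Fin d))) (hΩ : IsOpen Ω)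
    (U q : EuclideanSpace ℝ (Fin d) → ℝ)
    (hU : ContDiffOn ℝ 2 U Ω) (hq : ContDiffOn ℝ 2 q Ω)
    (hqpos : ∀ x ∈ Ω, 0 < q x)
    (hcom : ∀ x ∈ Ω, ε * lap q x - ⟪gradient U x, gradient q x⟫_ℝ = 0) :
    ∀ x ∈ Ω,
      ε * dvg (fun y =>
          Real.exp (-U y / ε) •
              gradient (fun z =>
                (Real.exp (-U z / ε) * q z * (1 - q z)) / Real.exp (-U z / ε)) y
            - ((2 * (Real.exp (-U y / ε) * q y * (1 - q y))) / q y) • gradient q y) x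
        = 0 := by
  intro x hx
  have hmem : Ω ∈ nhds x := hΩ.mem_nhds hx
  have hdq : ∀ y ∈ Ω, DifferentiableAt ℝ q y := fun y hy =>
    (hq.contDiffAt (hΩ.mem_nhds hy)).differentiableAt (by norm_num)
  have hdU : DifferentiableAt ℝ U x :=
    (hU.contDiffAt hmem).differentiableAt (by norm_num)
  have hdf : DifferentiableAt ℝ (fderiv ℝ q) x :=
    ((hq.contDiffAt hmem).fderiv_right (m := 1) (by norm_num)).differentiableAt (by norm_num)
  have hdg : DifferentiableAt ℝ (gradient q) x :=
    (InnerProductSpace.toDual ℝ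
      (EuclideanSpace ℝ (Fin d))).symm.toContinuousLinearEquiv.differentiableAt.comp x hdf
  have hE : HasFDerivAt (fun y => -Real.exp (-U y / ε))
      ((Real.exp (-U x / ε) / ε) • fderiv ℝ U x) x := by
    have h1 : HasFDerivAt (fun y => -U y / ε) ((-1 / ε) • fderiv ℝ U x) x := by
      have h2 := hdU.hasFDerivAt.const_mul (-1 / ε)
      refine h2.congr_of_eventuallyEq (Filter.Eventually.of_forall fun y => ?_)
      simp only []
      ring
    refine h1.exp.neg.congr_fderiv ?_
    ext v
    simp
    ring
  have hev : (fun y =>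
          Real.exp (-U y / ε) •
              gradient (fun z =>
                (Real.exp (-U z / ε) * q z * (1 - q z)) / Real.exp (-U z / ε)) y
            - ((2 * (Real.exp (-U y / ε) * q y * (1 - q y))) / q y) • gradient q y)
      =ᶠ[nhds x] fun y => (-Real.exp (-U y / ε)) • gradient q y := by
    filter_upwards [hmem] with y hy
    have hf : (fun z => (Real.exp (-U z / ε) * q z * (1 - q z)) / Real.exp (-U z / ε))
        = fun z => q z * (1 - q z) := by
      funext z
      have := (Real.exp_pos (-U z / ε)).ne'
      field_simp
    rw [hf]
    have hqy := (hqpos y hy).ne'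
    have h1 : HasFDerivAt (fun z => q z * (1 - q z)) ((1 - 2 * q y) • fderiv ℝ q y) y := by
      have h := (hdq y hy).hasFDerivAt
      refine (h.mul (h.const_sub 1)).congr_fderiv ?_
      ext v
      simp
      ring
    ext i
    simp only [PiLp.sub_apply, PiLp.smul_apply, grad_coord, h1.fderiv, smul_eq_mul,
      smul_apply]
    field_simp
    ring
  have hterm : ∀ i : Fin d, fderiv ℝ (fun y => (-Real.exp (-U y / ε)) • gradient q y) x
        (EuclideanSpace.single i 1) i
      = (Real.exp (-U x / ε) / ε) * (gradient U x i * gradient q x i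
        - ε * fderiv ℝ (fun y => fderiv ℝ q y (EuclideanSpace.single i 1)) x
            (EuclideanSpace.single i 1)) := by
    intro i
    have hp := (EuclideanSpace.proj i : EuclideanSpace ℝ (Fin d) →L[ℝ] ℝ).hasFDerivAt.comp x
      hdg.hasFDerivAt
    have hc : (fun y => fderiv ℝ q y (EuclideanSpace.single i 1))
        = (EuclideanSpace.proj i : EuclideanSpace ℝ (Fin d) →L[ℝ] ℝ) ∘ gradient q := by
      funext y
      simp [grad_coord]
    rw [hc, hp.fderiv, (hE.fun_smul hdg.hasFDerivAt).fderiv, grad_coord U]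
    simp
    field_simp
    ring
  unfold dvg
  rw [hev.fderiv_eq, Finset.sum_congr rfl fun i _ => hterm i, ← Finset.mul_sum,
    Finset.sum_sub_distrib, ← Finset.mul_sum]
  have h := hcom x hx
  have hin : ⟪gradient U x, gradient q x⟫_ℝ = ∑ i, gradient U x i * gradient q x i := by
    rw [PiLp.inner_apply]
    refine Finset.sum_congr rfl fun i _ => ?_
    simp [mul_comm]
  rw [hin] at h
  unfold lap at h
  have h' := sub_eq_zero.mp h
  rw [← h', sub_self, mul_zero, mul_zero]
end

section
/- Fix an integer n ≥ 2. Let Q be a reversible generator with respect to positive weights μ_1, …, μ_n > 0 whose support graph is connected (for all i, j there exist k_0 = i, …, k_m = j with Q_{k_l k_{l+1}} > 0 for each l), and let i_a ≠ i_b be distinct indices. Then the discrete committor is unique: if q and q' are both discrete committors for Q (with q_{i_a} = q'_{i_a} = 0, q_{i_b} = q'_{i_b} = 1, and Σ_j Q_{ij}(q_j − q_i) = Σ_j Q_{ij}(q'_j − q'_i) = 0 for all i ∉ {i_a, i_b}), then q = q'. -/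
theorem committor_aux {n : ℕ} (Q : Fin n → Fin n → ℝ)
    (hoff : ∀ i j, i ≠ j → 0 ≤ Q i j)
    (hconn : ∀ i j : Fin n, ∃ (m : ℕ) (k : Fin (m + 1) → Fin n),
      k 0 = i ∧ k (Fin.last m) = j ∧ ∀ l : Fin m, 0 < Q (k l.castSucc) (k l.succ))
    (ia ib : Fin n) (d : Fin n → ℝ) (ha : d ia = 0) (hb : d ib = 0)
    (hd : ∀ i, i ≠ ia → i ≠ ib → ∑ j, Q i j * (d j - d i) = 0) (x : Fin n) : d x ≤ 0 := by
  by_contra hx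
  push Not at hx
  obtain ⟨i0, -, hi0⟩ := Finset.exists_max_image Finset.univ d ⟨x, Finset.mem_univ x⟩
  have hmax : ∀ j, d j ≤ d i0 := fun j => hi0 j (Finset.mem_univ j)
  have hpos : 0 < d i0 := lt_of_lt_of_le hx (hmax x)
  obtain ⟨m, k, hk0, hkm, hk⟩ := hconn i0 ia
  have key : ∀ l : Fin (m + 1), d (k l) = d i0 := by
    intro l
    induction l using Fin.induction with
    | zero => rw [hk0]
    | succ l ih =>
      have h1 : k l.castSucc ≠ ia := by
        intro h
        rw [h] at ih
        linarith
      have h2 : k l.castSucc ≠ ib := by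
        intro h
        rw [h] at ih
        linarith
      have hs := hd _ h1 h2
      have hle : ∀ j ∈ Finset.univ, Q (k l.castSucc) j * (d j - d (k l.castSucc)) ≤ 0 := by
        intro j _
        by_cases hj : k l.castSucc = j
        · simp [hj]
        · exact mul_nonpos_of_nonneg_of_nonpos (hoff _ _ hj) (by rw [ih]; linarith [hmax j])
      have hz := (Finset.sum_eq_zero_iff_of_nonpos hle).1 hs (k l.succ) (Finset.mem_univ _)
      rcases mul_eq_zero.1 hz with h | h
      · exact absurd h (hk l).ne'
      · linarith
  have := key (Fin.last m)
  rw [hkm] at this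
  linarith

/-- For a reversible generator `Q` with connected support graph, the discrete committor
(with boundary values `0` at `i_a` and `1` at `i_b`) is unique. -/
theorem stmt_14 {n : ℕ} (hn : 2 ≤ n)
    (Q : Fin n → Fin n → ℝ) (μ : Fin n → ℝ) (hμ : ∀ i, 0 < μ i)
    (hoff : ∀ i j, i ≠ j → 0 ≤ Q i j)
    (hrow : ∀ i, ∑ j, Q i j = 0)
    (hdb : ∀ i j, μ i * Q i j = μ j * Q j i)
    (hconn : ∀ i j : Fin n, ∃ (m : ℕ) (k : Fin (m + 1) → Fin n),
      k 0 = i ∧ k (Fin.last m) = j ∧ ∀ l : Fin m, 0 < Q (k l.castSucc) (k l.succ))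
    (ia ib : Fin n) (hab : ia ≠ ib)
    (q q' : Fin n → ℝ)
    (hqa : q ia = 0) (hqb : q ib = 1)
    (hcom : ∀ i, i ≠ ia → i ≠ ib → ∑ j, Q i j * (q j - q i) = 0)
    (hqa' : q' ia = 0) (hqb' : q' ib = 1)
    (hcom' : ∀ i, i ≠ ia → i ≠ ib → ∑ j, Q i j * (q' j - q' i) = 0) :
    q = q' := by
  have h1 := committor_aux Q hoff hconn ia ib (fun i => q i - q' i) (by simp [hqa, hqa'])
    (by simp [hqb, hqb']) (by
      intro i h h'
      have e : ∑ j, Q i j * (q j - q i) - ∑ j, Q i j * (q' j - q' i) = 0 := by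
        rw [hcom i h h', hcom' i h h', sub_zero]
      rw [← e, ← Finset.sum_sub_distrib]
      exact Finset.sum_congr rfl fun j _ => by ring)
  have h2 := committor_aux Q hoff hconn ia ib (fun i => q' i - q i) (by simp [hqa, hqa'])
    (by simp [hqb, hqb']) (by
      intro i h h'
      have e : ∑ j, Q i j * (q' j - q' i) - ∑ j, Q i j * (q j - q i) = 0 := by
        rw [hcom i h h', hcom' i h h', sub_zero]
      rw [← e, ← Finset.sum_sub_distrib]
      exact Finset.sum_congr rfl fun j _ => by ring)
  funext i
  have a := h1 i
  have b := h2 i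
  linarith
end
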